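/- Suppose u₀ is an initial world in a Kripke model N with reflexive and transitive accessibility relation, and suppose that for every n there are n independent buttons at u₀. Then every propositional modal formula valid at u₀ (meaning every uniform substitution instance of it is true at u₀ in N) is provable in the modal logic Grz.2. -/

import Mathlib

namespace GrzPaper

/-- Propositional modal formulas, built from variables, falsum, implication and box. -/
inductive Formula : Type
  | var : ℕ → Formula
  | fls : Formula
  | impl : Formula → Formula → Formula
  | box : Formula → Formula
deriving DecidableEq

namespace Formula

def neg (φ : Formula) : Formula := impl φ fls
def tru : Formula := neg fls
def disj (φ ψ : Formula) : Formula := impl (neg φ) ψ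
def conj (φ ψ : Formula) : Formula := neg (impl φ (neg ψ))
def dia (φ : Formula) : Formula := neg (box (neg φ))

/-- Uniform substitution. -/
def subst (σ : ℕ → Formula) : Formula → Formula
  | var n => σ n
  | fls => fls
  | impl a b => impl (subst σ a) (subst σ b)
  | box a => box (subst σ a)

/-- Propositional (Boolean) evaluation, treating variables and boxed formulas as atoms. -/
def evalProp (v : Formula → Bool) : Formula → Bool
  | var n => v (var n)
  | fls => false
  | impl a b => !(evalProp v a) || evalProp v b
  | box a => v (box a)

/-- A propositional tautology: true under every Boolean valuation of the atoms
(variables and boxed subformulas). -/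
def Tautology (φ : Formula) : Prop := ∀ v, evalProp v φ = true

end Formula

open Formula

/-- A normal modal logic: contains all propositional tautologies and all instances of K,
closed under modus ponens, necessitation and uniform substitution. -/
structure IsNormalLogic (L : Set Formula) : Prop where
  taut : ∀ φ, Tautology φ → φ ∈ L
  axK : ∀ φ ψ, impl (box (impl φ ψ)) (impl (box φ) (box ψ)) ∈ L
  mp : ∀ φ ψ, impl φ ψ ∈ L → φ ∈ L → ψ ∈ L
  nec : ∀ φ, φ ∈ L → box φ ∈ L
  subst : ∀ φ σ, φ ∈ L → φ.subst σ ∈ L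

/-- The normal modal logic generated by a set of axioms: the smallest normal modal
logic containing them. -/
def Generated (Ax : Set Formula) : Set Formula :=
  ⋂₀ {L | IsNormalLogic L ∧ Ax ⊆ L}

def pv : Formula := var 0
def qv : Formula := var 1

def axT : Formula := impl (box pv) pv
def axFour : Formula := impl (box pv) (box (box pv))
def axGrz : Formula := impl (box (impl (box (impl pv (box pv))) pv)) pv
def axPoint2 : Formula := impl (dia (box pv)) (box (dia pv))
def axPoint3 : Formula := disj (box (impl (box pv) qv)) (box (impl (box qv) pv))

/-- penultimate(φ) : φ ∧ ◇¬φ ∧ □(¬φ → □¬φ). -/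
def penultimate (φ : Formula) : Formula :=
  conj φ (conj (dia (neg φ)) (box (impl (neg φ) (box (neg φ)))))

/-- contingent(φ) : ◇φ ∧ ◇¬φ. -/
def contingent (φ : Formula) : Formula := conj (dia φ) (dia (neg φ))

/-- The axiom Grz* : contingent(p) → ◇(penultimate(p) ∨ penultimate(¬p)). -/
def axGrzStar : Formula :=
  impl (contingent pv) (dia (disj (penultimate pv) (penultimate (neg pv))))

def Grz : Set Formula := Generated {axGrz}
def GrzStarLogic : Set Formula := Generated {axGrzStar}
def S4GrzStar : Set Formula := Generated {axT, axFour, axGrzStar}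
def Grz2 : Set Formula := Generated {axGrz, axPoint2}
def Grz3 : Set Formula := Generated {axGrz, axPoint3}
def KLogic : Set Formula := Generated ∅

/-- A Kripke model: an accessibility relation together with a valuation. -/
structure KripkeModel (W : Type) where
  rel : W → W → Prop
  val : ℕ → W → Prop

/-- Satisfaction of a modal formula at a world of a Kripke model. -/
def Satisfies {W : Type} (M : KripkeModel W) : W → Formula → Prop
  | w, .var n => M.val n w
  | _, .fls => False
  | w, .impl a b => Satisfies M w a → Satisfies M w b
  | w, .box a => ∀ v, M.rel w v → Satisfies M v a

/-- Validity of a formula on a Kripke frame. -/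
def ValidOnFrame (W : Type) (R : W → W → Prop) (φ : Formula) : Prop :=
  ∀ (val : ℕ → W → Prop) (w : W), Satisfies ⟨R, val⟩ w φ

/-- A model labeling of (M,w₀) for (N,u₀): a substitution σ such that every formula is
true at (M,w₀) iff its σ-instance is true at (N,u₀). -/
def ModelLabeling {W U : Type} (M : KripkeModel W) (w0 : W) (N : KripkeModel U) (u0 : U)
    (σ : ℕ → Formula) : Prop :=
  ∀ φ : Formula, Satisfies M w0 φ ↔ Satisfies N u0 (φ.subst σ)

/-- A frame labeling of the frame (W,R) with initial node w₀ for the pointed model (N,u₀). -/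
def FrameLabeling {W U : Type} (R : W → W → Prop) (w0 : W) (N : KripkeModel U) (u0 : U)
    (Φ : W → Formula) : Prop :=
  Satisfies N u0 (Φ w0) ∧
  (∀ u, N.rel u0 u → ∀ w, Satisfies N u (Φ w) →
    ∀ w', (Satisfies N u (dia (Φ w')) ↔ R w w')) ∧
  (∀ u, N.rel u0 u → ∃! w, Satisfies N u (Φ w))

def bigOr : List Formula → Formula
  | [] => fls
  | φ :: l => disj φ (bigOr l)

def bigAnd : List Formula → Formula
  | [] => tru
  | φ :: l => conj φ (bigAnd l)

open Classical in
/-- The disjunction ⋁ {Φ w : P w}. -/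
noncomputable def labelFormula {W : Type} [Fintype W] (Φ : W → Formula) (P : W → Prop) :
    Formula :=
  bigOr ((Finset.univ.filter P).toList.map Φ)

/-- Θ_A : the formula asserting that the button pattern is exactly A. -/
noncomputable def Theta {n : ℕ} (b : Fin n → Formula) (A : Finset (Fin n)) : Formula :=
  bigAnd ((Finset.univ : Finset (Fin n)).toList.map
    (fun i => if i ∈ A then box (b i) else neg (box (b i))))

/-- b₀,…,b_{n−1} are independent buttons at u₀: none is pushed (necessary) at u₀, and
necessarily, whenever the button pattern is exactly A, every larger pattern is possible. -/
def IndependentButtons {U : Type} (N : KripkeModel U) (u0 : U) {n : ℕ}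
    (b : Fin n → Formula) : Prop :=
  (∀ i, ¬ Satisfies N u0 (box (b i))) ∧
  ∀ A : Finset (Fin n), ∀ u, N.rel u0 u → Satisfies N u (Theta b A) →
    ∀ A' : Finset (Fin n), A ⊆ A' → Satisfies N u (dia (Theta b A'))

/-- r₀,…,r_{n−1} form a ratchet of length n at u₀. -/
def Ratchet {U : Type} (N : KripkeModel U) (u0 : U) {n : ℕ} (r : Fin n → Formula) : Prop :=
  (∀ i : Fin n, (i.val = 0 → Satisfies N u0 (box (r i))) ∧
      (0 < i.val → ¬ Satisfies N u0 (box (r i)))) ∧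
  (∀ u, N.rel u0 u → ∀ i j : Fin n, i < j →
      Satisfies N u (box (r j)) → Satisfies N u (box (r i))) ∧
  (∀ u, N.rel u0 u → ∀ i : Fin n, 0 < i.val →
      (∀ j : Fin n, Satisfies N u (box (r j)) ↔ j < i) →
        ∃ v, N.rel u v ∧ ∀ j : Fin n, Satisfies N v (box (r j)) ↔ j ≤ i)

/-- A (finite) tree order: a partial order with a least element in which the set of
predecessors of every element is linearly ordered. -/
def IsTreeOrder {W : Type} (R : W → W → Prop) : Prop :=
  IsPartialOrder W R ∧ (∃ r, ∀ x, R r x) ∧ ∀ x a b, R a x → R b x → R a b ∨ R b a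

/-- A baled tree order: a partial order with a greatest element t whose removal
leaves a tree. -/
def IsBaledTreeOrder {W : Type} (R : W → W → Prop) : Prop :=
  IsPartialOrder W R ∧ ∃ t : W, (∀ x, R x t) ∧
    (∃ r, r ≠ t ∧ ∀ x, x ≠ t → R r x) ∧
    (∀ x a b, x ≠ t → R a x → R b x → R a b ∨ R b a)

/-- Height of a node: the number of its strict predecessors. -/
noncomputable def heightOf {W : Type} (R : W → W → Prop) (x : W) : ℕ :=
  Nat.card {y : W // R y x ∧ y ≠ x}

/-- y is an immediate successor of x. -/
def ImmSucc {W : Type} (R : W → W → Prop) (x y : W) : Prop :=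
  R x y ∧ x ≠ y ∧ ∀ z, R x z → R z y → z = x ∨ z = y

def IsMaximal {W : Type} (R : W → W → Prop) (x : W) : Prop := ∀ z, R x z → z = x

/-- A regular finite tree: all maximal elements have the same height, and any two
elements of the same height have the same number of immediate successors. -/
def IsRegularTree {W : Type} (R : W → W → Prop) : Prop :=
  IsTreeOrder R ∧
  (∀ x y, IsMaximal R x → IsMaximal R y → heightOf R x = heightOf R y) ∧
  (∀ x y, heightOf R x = heightOf R y →
    Nat.card {z : W // ImmSucc R x z} = Nat.card {z : W // ImmSucc R y z})


/-- A normal logic containing the axioms of Grz.2. -/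
structure IsGrz2Logic (L : Set Formula) : Prop where
  normal : IsNormalLogic L
  grz : axGrz ∈ L
  point2 : axPoint2 ∈ L

/-- A set of formulas containing the logic `L` and closed under modus ponens. -/
structure IsTheory (L Γ : Set Formula) : Prop where
  logic : ∀ φ ∈ L, φ ∈ Γ
  mp : ∀ φ ψ, impl φ ψ ∈ Γ → φ ∈ Γ → ψ ∈ Γ

/-- A complete consistent theory over `L`. -/
structure IsMCS (L Γ : Set Formula) : Prop extends IsTheory L Γ where
  fls : fls ∉ Γ
  complete : ∀ φ, φ ∈ Γ ∨ neg φ ∈ Γ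

theorem tautology_weaken (φ ψ : Formula) : Tautology (impl φ (impl ψ φ)) := by
  intro v
  simp only [evalProp]
  cases evalProp v φ <;> cases evalProp v ψ <;> rfl

theorem tautology_distrib (φ ψ χ : Formula) :
    Tautology (impl (impl φ (impl ψ χ)) (impl (impl φ ψ) (impl φ χ))) := by
  intro v
  simp only [evalProp]
  cases evalProp v φ <;> cases evalProp v ψ <;> cases evalProp v χ <;> rfl

theorem tautology_self (φ : Formula) : Tautology (impl φ φ) := by
  intro v
  simp only [evalProp]
  cases evalProp v φ <;> rfl

theorem tautology_exfalso (φ : Formula) : Tautology (impl fls φ) := by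
  intro v
  simp only [evalProp]
  rfl

theorem tautology_cases (φ ψ : Formula) :
    Tautology (impl (impl φ ψ) (impl (impl (neg φ) ψ) ψ)) := by
  intro v
  simp only [evalProp, neg]
  cases evalProp v φ <;> cases evalProp v ψ <;> rfl

section Theories

variable {L Γ : Set Formula}

theorem IsTheory.of_tautology (hL : IsNormalLogic L) (h : IsTheory L Γ) {φ : Formula}
    (hφ : Tautology φ) : φ ∈ Γ :=
  h.logic _ (hL.taut _ hφ)

theorem IsTheory.impl_of_right (hL : IsNormalLogic L) (h : IsTheory L Γ) {φ : Formula}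
    (ψ : Formula) (hφ : φ ∈ Γ) : impl ψ φ ∈ Γ :=
  h.mp _ _ (h.of_tautology hL (tautology_weaken φ ψ)) hφ

/-- The theory generated by adding the hypothesis `χ` to `Γ`. -/
theorem IsTheory.adjoin (hL : IsNormalLogic L) (h : IsTheory L Γ) (χ : Formula) :
    IsTheory L {φ | impl χ φ ∈ Γ} where
  logic φ hφ := h.impl_of_right hL χ (h.logic φ hφ)
  mp φ ψ h₁ h₂ := h.mp _ _ (h.mp _ _ (h.of_tautology hL (tautology_distrib χ φ ψ)) h₁) h₂

theorem IsTheory.unbox (hL : IsNormalLogic L) (h : IsTheory L Γ) :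
    IsTheory L {φ | box φ ∈ Γ} where
  logic φ hφ := h.logic _ (hL.nec φ hφ)
  mp φ ψ h₁ h₂ := h.mp _ _ (h.mp _ _ (h.logic _ (hL.axK φ ψ)) h₁) h₂

theorem isTheory_self (hL : IsNormalLogic L) : IsTheory L L where
  logic _ h := h
  mp := hL.mp

/-- The Lindenbaum lemma. -/
theorem IsTheory.exists_mcs (hL : IsNormalLogic L) (h : IsTheory L Γ) {ψ : Formula}
    (hψ : ψ ∉ Γ) : ∃ Δ, IsMCS L Δ ∧ Γ ⊆ Δ ∧ ψ ∉ Δ := by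
  obtain ⟨Δ, hΓΔ, hmax⟩ := zorn_subset_nonempty {Δ | IsTheory L Δ ∧ ψ ∉ Δ} (by
    intro c hc hchain ⟨Θ, hΘ⟩
    refine ⟨⋃₀ c, ⟨⟨fun φ hφ => ⟨Θ, hΘ, (hc hΘ).1.logic φ hφ⟩, ?_⟩, ?_⟩,
      fun s hs => Set.subset_sUnion_of_mem hs⟩
    · rintro φ χ ⟨s, hs, hφχ⟩ ⟨t, ht, hφ⟩
      rcases hchain.total hs ht with hst | hst
      · exact ⟨t, ht, (hc ht).1.mp _ _ (hst hφχ) hφ⟩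
      · exact ⟨s, hs, (hc hs).1.mp _ _ hφχ (hst hφ)⟩
    · rintro ⟨s, hs, hψs⟩
      exact (hc hs).2 hψs) Γ ⟨h, hψ⟩
  obtain ⟨hΔ, hψΔ⟩ := hmax.prop
  have key : ∀ χ, χ ∉ Δ → impl χ ψ ∈ Δ := by
    intro χ hχ
    by_contra hn
    exact hχ (hmax.le_of_ge (y := {φ | impl χ φ ∈ Δ}) ⟨hΔ.adjoin hL χ, hn⟩
      (fun φ hφ => hΔ.impl_of_right hL χ hφ) (hΔ.of_tautology hL (tautology_self χ)))
  refine ⟨Δ, ⟨hΔ, fun hf => ?_, fun χ => ?_⟩, hΓΔ, hψΔ⟩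
  · exact hψΔ (hΔ.mp _ _ (hΔ.of_tautology hL (tautology_exfalso ψ)) hf)
  · by_contra! hn
    exact hψΔ (hΔ.mp _ _ (hΔ.mp _ _ (hΔ.of_tautology hL (tautology_cases χ ψ))
      (key _ hn.1)) (key _ hn.2))

theorem IsMCS.mem_impl (hL : IsNormalLogic L) (h : IsMCS L Γ) (φ ψ : Formula) :
    impl φ ψ ∈ Γ ↔ (φ ∈ Γ → ψ ∈ Γ) := by
  refine ⟨h.mp φ ψ, fun hi => ?_⟩
  rcases h.complete φ with hφ | hφ
  · exact h.toIsTheory.impl_of_right hL φ (hi hφ)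
  · exact ((h.toIsTheory.adjoin hL φ).mp _ _
      (h.toIsTheory.impl_of_right hL φ (h.toIsTheory.of_tautology hL (tautology_exfalso ψ)))) hφ

theorem IsMCS.mem_neg (hL : IsNormalLogic L) (h : IsMCS L Γ) (φ : Formula) :
    neg φ ∈ Γ ↔ φ ∉ Γ := by
  rw [neg, h.mem_impl hL]
  exact ⟨fun hi hφ => h.fls (hi hφ), fun hn hφ => (hn hφ).elim⟩

theorem IsMCS.mem_conj (hL : IsNormalLogic L) (h : IsMCS L Γ) (φ ψ : Formula) :
    conj φ ψ ∈ Γ ↔ φ ∈ Γ ∧ ψ ∈ Γ := by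
  rw [conj, h.mem_neg hL, h.mem_impl hL, h.mem_neg hL]
  tauto

/-- Accessibility in the canonical frame. -/
def CanonicalRel (Γ Δ : Set Formula) : Prop := ∀ φ, box φ ∈ Γ → φ ∈ Δ

theorem IsMCS.mem_box (hL : IsNormalLogic L) (h : IsMCS L Γ) (φ : Formula) :
    box φ ∈ Γ ↔ ∀ Δ, IsMCS L Δ → CanonicalRel Γ Δ → φ ∈ Δ := by
  refine ⟨fun hφ Δ _ hR => hR φ hφ, fun hall => ?_⟩
  by_contra hn
  obtain ⟨Δ, hΔ, hsub, hφ⟩ := (h.toIsTheory.unbox hL).exists_mcs hL (ψ := φ) hn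
  exact hφ (hall Δ hΔ fun χ hχ => hsub hχ)

theorem IsMCS.mem_dia (hL : IsNormalLogic L) (h : IsMCS L Γ) (φ : Formula) :
    dia φ ∈ Γ ↔ ∃ Δ, IsMCS L Δ ∧ CanonicalRel Γ Δ ∧ φ ∈ Δ := by
  rw [dia, h.mem_neg hL, h.mem_box hL]
  push Not
  refine exists_congr fun Δ => ?_
  constructor
  · rintro ⟨hΔ, hR, hn⟩
    rw [hΔ.mem_neg hL, not_not] at hn
    exact ⟨hΔ, hR, hn⟩
  · rintro ⟨hΔ, hR, hφ⟩
    exact ⟨hΔ, hR, fun hn => (hΔ.mem_neg hL φ).1 hn hφ⟩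

end Theories

section Canonical

variable {L Γ Δ : Set Formula}

theorem IsMCS.grz (hL : IsGrz2Logic L) (h : IsMCS L Γ) (φ : Formula)
    (hφ : box (impl (box (impl φ (box φ))) φ) ∈ Γ) : φ ∈ Γ :=
  h.mp _ _ (h.logic _ (hL.normal.subst _ (fun _ => φ) hL.grz)) hφ

theorem IsMCS.canonicalRel_refl (hL : IsGrz2Logic L) (h : IsMCS L Γ) : CanonicalRel Γ Γ := by
  intro φ hφ
  refine h.grz hL φ ?_
  rw [h.mem_box hL.normal]
  intro Δ hΔ hR
  exact hΔ.toIsTheory.impl_of_right hL.normal _ (hR φ hφ)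

theorem IsMCS.box_box (hL : IsGrz2Logic L) (h : IsMCS L Γ) {φ : Formula} (hφ : box φ ∈ Γ) :
    box (box φ) ∈ Γ := by
  have hN := hL.normal
  have hmem : ∀ {Δ}, IsMCS L Δ → (conj φ (impl (box φ) (box (box φ))) ∈ Δ ↔
      φ ∈ Δ ∧ (box φ ∈ Δ → box (box φ) ∈ Δ)) := fun hΔ => by
    rw [hΔ.mem_conj hN, hΔ.mem_impl hN]
  refine ((hmem h).1 (h.grz hL _ ?_)).2 hφ
  rw [h.mem_box hN]
  intro Δ hΔ hR
  rw [hΔ.mem_impl hN, hmem hΔ]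
  refine fun hstep => ⟨hR φ hφ, fun _ => ?_⟩
  rw [hΔ.mem_box hN]
  intro Θ hΘ hΔΘ
  by_contra hn
  have hmΘ := hΔΘ _ hstep
  rw [hΘ.mem_impl hN, hmem hΘ] at hmΘ
  refine hn ((hΘ.mem_box hN _).2 fun Ξ hΞ hΘΞ => ?_)
  exact ((hmem hΞ).1 (hΘΞ _ (hmΘ ⟨hΔΘ φ ‹_›, fun h' => (hn h').elim⟩))).1

theorem IsMCS.box_mem_of_rel (hL : IsGrz2Logic L) (h : IsMCS L Γ) (hR : CanonicalRel Γ Δ)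
    {φ : Formula} (hφ : box φ ∈ Γ) : box φ ∈ Δ :=
  hR _ (h.box_box hL hφ)

theorem IsMCS.canonicalRel_trans (hL : IsGrz2Logic L) {Θ : Set Formula} (h : IsMCS L Γ)
    (hR : CanonicalRel Γ Δ) (hS : CanonicalRel Δ Θ) : CanonicalRel Γ Θ :=
  fun _ hφ => hS _ (h.box_mem_of_rel hL hR hφ)

theorem IsMCS.exists_rel_of_box_notMem (hL : IsGrz2Logic L) (h : IsMCS L Γ) {φ : Formula}
    (hφ : box φ ∉ Γ) :
    ∃ Δ, IsMCS L Δ ∧ CanonicalRel Γ Δ ∧ φ ∉ Δ ∧ box (impl φ (box φ)) ∈ Δ := by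
  have hN := hL.normal
  have hn : box (impl (box (impl φ (box φ))) φ) ∉ Γ := fun hb =>
    hφ ((h.mem_box hN φ).2 fun Δ hΔ hR => hΔ.grz hL φ (h.box_mem_of_rel hL hR hb))
  rw [h.mem_box hN] at hn
  push Not at hn
  obtain ⟨Δ, hΔ, hR, hi⟩ := hn
  rw [hΔ.mem_impl hN] at hi
  push Not at hi
  exact ⟨Δ, hΔ, hR, hi.2, hi.1⟩

/-- The set of formulas that are eventually necessary, as seen from `Γ`. -/
def eventual (Γ : Set Formula) : Set Formula := {φ | dia (box φ) ∈ Γ}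

theorem IsMCS.mem_eventual (hL : IsGrz2Logic L) (h : IsMCS L Γ) {φ : Formula} :
    φ ∈ eventual Γ ↔ ∃ Δ, IsMCS L Δ ∧ CanonicalRel Γ Δ ∧ box φ ∈ Δ :=
  h.mem_dia hL.normal _

theorem IsMCS.eventual_isMCS (hL : IsGrz2Logic L) (h : IsMCS L Γ) : IsMCS L (eventual Γ) where
  logic φ hφ := (h.mem_eventual hL).2
    ⟨Γ, h, h.canonicalRel_refl hL, h.logic _ (hL.normal.nec φ hφ)⟩
  mp φ ψ h₁ h₂ := by
    have hN := hL.normal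
    obtain ⟨Δ, hΔ, hR, hi⟩ := (h.mem_eventual hL).1 h₁
    obtain ⟨Θ, hΘ, hS, hφ⟩ := (h.mem_eventual hL).1 h₂
    have hd : dia (box (box φ)) ∈ Γ := (h.mem_dia hN _).2 ⟨Θ, hΘ, hS, hΘ.box_box hL hφ⟩
    have hbd : box (dia (box φ)) ∈ Γ :=
      h.mp _ _ (h.logic _ (hN.subst _ (fun _ => box φ) hL.point2)) hd
    obtain ⟨Ξ, hΞ, hΔΞ, hφΞ⟩ := (hΔ.mem_dia hN _).1 (hR _ hbd)
    refine (h.mem_eventual hL).2 ⟨Ξ, hΞ, h.canonicalRel_trans hL hR hΔΞ, ?_⟩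
    exact (hΞ.toIsTheory.unbox hN).mp _ _ (hΔ.box_mem_of_rel hL hΔΞ hi) hφΞ
  fls hf := by
    obtain ⟨Δ, hΔ, -, hb⟩ := (h.mem_eventual hL).1 hf
    exact hΔ.fls (hΔ.canonicalRel_refl hL _ hb)
  complete φ := by
    have hN := hL.normal
    by_cases hφ : box φ ∈ Γ
    · exact Or.inl ((h.mem_eventual hL).2 ⟨Γ, h, h.canonicalRel_refl hL, hφ⟩)
    obtain ⟨Δ, hΔ, hR, -, hstep⟩ := h.exists_rel_of_box_notMem hL hφ
    by_cases hn : box (neg φ) ∈ Δ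
    · exact Or.inr ((h.mem_eventual hL).2 ⟨Δ, hΔ, hR, hn⟩)
    obtain ⟨Θ, hΘ, hS, hφΘ⟩ := (hΔ.mem_dia hN φ).1 ((hΔ.mem_neg hN _).2 hn)
    exact Or.inl ((h.mem_eventual hL).2
      ⟨Θ, hΘ, h.canonicalRel_trans hL hR hS, hΘ.mp _ _ (hS _ hstep) hφΘ⟩)

theorem IsMCS.canonicalRel_eventual (hL : IsGrz2Logic L) (h : IsMCS L Γ) (hΔ : IsMCS L Δ)
    (hR : CanonicalRel Γ Δ) : CanonicalRel Δ (eventual Γ) :=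
  fun _ hφ => (h.mem_eventual hL).2 ⟨Δ, hΔ, hR, hφ⟩

theorem IsMCS.box_mem_eventual (hL : IsGrz2Logic L) (h : IsMCS L Γ) {φ : Formula}
    (hφ : φ ∈ eventual Γ) : box φ ∈ eventual Γ := by
  obtain ⟨Δ, hΔ, hR, hb⟩ := (h.mem_eventual hL).1 hφ
  exact (h.mem_eventual hL).2 ⟨Δ, hΔ, hR, hΔ.box_box hL hb⟩

end Canonical

namespace Formula

/-- The finite set of subformulas. -/
def subformulas : Formula → Finset Formula
  | var n => {var n}
  | fls => {fls}
  | impl a b => insert (impl a b) (subformulas a ∪ subformulas b)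
  | box a => insert (box a) (subformulas a)

theorem self_mem_subformulas (φ : Formula) : φ ∈ φ.subformulas := by
  cases φ <;> simp [subformulas]

theorem subformulas_impl {φ a b : Formula} (h : impl a b ∈ φ.subformulas) :
    a ∈ φ.subformulas ∧ b ∈ φ.subformulas := by
  induction φ with
  | var n => simp [subformulas] at h
  | fls => simp [subformulas] at h
  | impl c d hc hd =>
    simp only [subformulas, Finset.mem_insert, Finset.mem_union, impl.injEq] at h ⊢
    rcases h with ⟨rfl, rfl⟩ | h | h
    · exact ⟨Or.inr (Or.inl (self_mem_subformulas _)), Or.inr (Or.inr (self_mem_subformulas _))⟩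
    · have := hc h
      tauto
    · have := hd h
      tauto
  | box c hc =>
    simp only [subformulas, Finset.mem_insert, reduceCtorEq, false_or] at h ⊢
    have := hc h
    tauto

theorem subformulas_box {φ a : Formula} (h : box a ∈ φ.subformulas) : a ∈ φ.subformulas := by
  induction φ with
  | var n => simp [subformulas] at h
  | fls => simp [subformulas] at h
  | impl c d hc hd =>
    simp only [subformulas, Finset.mem_insert, Finset.mem_union, reduceCtorEq, false_or] at h ⊢
    rcases h with h | h
    · exact Or.inr (Or.inl (hc h))
    · exact Or.inr (Or.inr (hd h))
  | box c hc =>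
    simp only [subformulas, Finset.mem_insert, box.injEq] at h ⊢
    rcases h with rfl | h
    · exact Or.inr (self_mem_subformulas _)
    · exact Or.inr (hc h)

/-- The formulas whose boxes are recorded in the finite model for `φ`. -/
def boxScope (φ : Formula) : Finset Formula :=
  φ.subformulas ∪ φ.subformulas.image neg ∪ φ.subformulas.image fun a => impl a (box a)

end Formula

section FiniteModel

/-- The finite information about a set of formulas recorded in the finite model for `φ`:
which subformulas it contains, and which boxes of formulas in scope. -/
@[ext]
structure FormulaType where
  loc : Finset Formula
  boxes : Finset Formula

/-- The order on types used in the completeness proof of Boolos for Grz. -/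
instance : PartialOrder FormulaType where
  le x y := x.boxes ⊆ y.boxes ∧ (y.boxes ⊆ x.boxes → x = y)
  le_refl x := ⟨subset_rfl, fun _ => rfl⟩
  le_trans x y z hxy hyz := ⟨hxy.1.trans hyz.1, fun h =>
    (hxy.2 (hyz.1.trans h)).trans (hyz.2 (h.trans hxy.1))⟩
  le_antisymm _ _ hxy hyx := hxy.2 hyx.1

open Classical in
/-- The type of a set of formulas. -/
noncomputable def typeOf (φ : Formula) (Γ : Set Formula) : FormulaType where
  loc := φ.subformulas.filter (· ∈ Γ)
  boxes := φ.boxScope.filter (box · ∈ Γ)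

theorem mem_typeOf_loc {φ ψ : Formula} {Γ : Set Formula} :
    ψ ∈ (typeOf φ Γ).loc ↔ ψ ∈ φ.subformulas ∧ ψ ∈ Γ := by
  simp [typeOf]

theorem mem_typeOf_boxes {φ ψ : Formula} {Γ : Set Formula} :
    ψ ∈ (typeOf φ Γ).boxes ↔ ψ ∈ φ.boxScope ∧ box ψ ∈ Γ := by
  simp [typeOf]

/-- The worlds of the finite model for `φ` above the type of `Γ`. -/
def ModelWorld (L : Set Formula) (φ : Formula) (Γ : Set Formula) : Type :=
  {x : FormulaType // ∃ Δ, IsMCS L Δ ∧ CanonicalRel Γ Δ ∧ typeOf φ Δ = x ∧ typeOf φ Γ ≤ x}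

instance (L : Set Formula) (φ : Formula) (Γ : Set Formula) :
    PartialOrder (ModelWorld L φ Γ) :=
  inferInstanceAs (PartialOrder {x : FormulaType //
    ∃ Δ, IsMCS L Δ ∧ CanonicalRel Γ Δ ∧ typeOf φ Δ = x ∧ typeOf φ Γ ≤ x})

theorem finite_modelWorld (L : Set Formula) (φ : Formula) (Γ : Set Formula) :
    Finite (ModelWorld L φ Γ) := by
  let f : ModelWorld L φ Γ → φ.subformulas.powerset × φ.boxScope.powerset := fun x =>
    (⟨x.1.loc, by
      obtain ⟨Δ, -, -, hx, -⟩ := x.2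
      rw [← hx, Finset.mem_powerset]
      exact fun ψ hψ => (mem_typeOf_loc.1 hψ).1⟩,
    ⟨x.1.boxes, by
      obtain ⟨Δ, -, -, hx, -⟩ := x.2
      rw [← hx, Finset.mem_powerset]
      exact fun ψ hψ => (mem_typeOf_boxes.1 hψ).1⟩)
  refine Finite.of_injective f fun x y hxy => ?_
  simp only [f, Prod.mk.injEq, Subtype.mk.injEq] at hxy
  exact Subtype.ext (FormulaType.ext hxy.1 hxy.2)

variable {L Γ : Set Formula}

theorem typeOf_le_eventual (hL : IsGrz2Logic L) (h : IsMCS L Γ) {Δ : Set Formula}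
    (hΔ : IsMCS L Δ) (hR : CanonicalRel Γ Δ) (φ : Formula) :
    typeOf φ Δ ≤ typeOf φ (eventual Γ) := by
  have hN := hL.normal
  have hE := h.eventual_isMCS hL
  have hsub : (typeOf φ Δ).boxes ⊆ (typeOf φ (eventual Γ)).boxes := fun ψ hψ => by
    rw [mem_typeOf_boxes] at hψ ⊢
    exact ⟨hψ.1, hΔ.box_mem_of_rel hL (h.canonicalRel_eventual hL hΔ hR) hψ.2⟩
  refine ⟨hsub, fun hsup => ?_⟩
  have transfer : ∀ ψ ∈ φ.boxScope, ψ ∈ eventual Γ → ψ ∈ Δ := fun ψ hs hψ =>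
    hΔ.canonicalRel_refl hL ψ (mem_typeOf_boxes.1
      (hsup (mem_typeOf_boxes.2 ⟨hs, h.box_mem_eventual hL hψ⟩))).2
  refine FormulaType.ext (Finset.ext fun ψ => ?_) (hsub.antisymm hsup)
  rw [mem_typeOf_loc, mem_typeOf_loc]
  refine and_congr_right fun hψ => ⟨fun hψΔ => ?_, transfer ψ (by simp [boxScope, hψ])⟩
  by_contra hn
  refine (hΔ.mem_neg hN ψ).1 (transfer (neg ψ) ?_ ((hE.mem_neg hN ψ).2 hn)) hψΔ
  simp only [boxScope, Finset.mem_union, Finset.mem_image]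
  exact Or.inl (Or.inr ⟨ψ, hψ, rfl⟩)

theorem satisfies_modelWorld (hL : IsGrz2Logic L) (h : IsMCS L Γ) (φ : Formula) :
    ∀ ψ ∈ φ.subformulas, ∀ x : ModelWorld L φ Γ,
      Satisfies ⟨(· ≤ ·), fun n y => var n ∈ y.1.loc⟩ x ψ ↔ ψ ∈ x.1.loc := by
  have hN := hL.normal
  intro ψ
  induction ψ with
  | var n => exact fun _ _ => Iff.rfl
  | fls =>
    rintro - ⟨x, Δ, hΔ, -, rfl, -⟩
    simp [Satisfies, mem_typeOf_loc, hΔ.fls]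
  | impl a b iha ihb =>
    intro hs x
    obtain ⟨ha, hb⟩ := subformulas_impl hs
    rw [Satisfies, iha ha, ihb hb]
    obtain ⟨x, Δ, hΔ, -, rfl, -⟩ := x
    simp [mem_typeOf_loc, hΔ.mem_impl hN, ha, hb, hs]
  | box a iha =>
    intro hs x
    have ha := subformulas_box hs
    rw [Satisfies]
    simp only [iha ha]
    obtain ⟨x, Δ, hΔ, hR, rfl, hle⟩ := x
    constructor
    · intro hall
      rw [mem_typeOf_loc]
      refine ⟨hs, ?_⟩
      by_contra hn
      have haΔ := (mem_typeOf_loc.1 (hall ⟨_, Δ, hΔ, hR, rfl, hle⟩ le_rfl)).2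
      obtain ⟨Θ, hΘ, hS, haΘ, hstep⟩ := hΔ.exists_rel_of_box_notMem hL hn
      have hlt : typeOf φ Δ ≤ typeOf φ Θ := by
        refine ⟨fun χ hχ => ?_, fun hsup => ?_⟩
        · rw [mem_typeOf_boxes] at hχ ⊢
          exact ⟨hχ.1, hΔ.box_mem_of_rel hL hS hχ.2⟩
        · have hscope : impl a (box a) ∈ φ.boxScope := by
            simp only [boxScope, Finset.mem_union, Finset.mem_image]
            exact Or.inr ⟨a, ha, rfl⟩
          have := (mem_typeOf_boxes.1 (hsup (mem_typeOf_boxes.2 ⟨hscope, hstep⟩))).2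
          exact (hn (hΔ.mp _ _ (hΔ.canonicalRel_refl hL _ this) haΔ)).elim
      exact haΘ (mem_typeOf_loc.1 (hall
        ⟨_, Θ, hΘ, h.canonicalRel_trans hL hR hS, rfl, hle.trans hlt⟩ hlt)).2
    · rintro hbox ⟨y, Θ, hΘ, hS, rfl, hle'⟩ hxy
      have hscope : a ∈ φ.boxScope := by simp [boxScope, ha]
      have := hxy.1 (mem_typeOf_boxes.2 ⟨hscope, (mem_typeOf_loc.1 hbox).2⟩)
      exact mem_typeOf_loc.2 ⟨ha, hΘ.canonicalRel_refl hL _ (mem_typeOf_boxes.1 this).2⟩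

/-- Grz.2 is complete for finite partial orders with least and greatest elements. -/
theorem exists_finite_countermodel (hL : IsGrz2Logic L) {φ : Formula} (hφ : φ ∉ L) :
    ∃ (W : Type) (_ : Finite W) (_ : PartialOrder W) (_ : BoundedOrder W)
      (val : ℕ → W → Prop), ¬ Satisfies ⟨(· ≤ ·), val⟩ (⊥ : W) φ := by
  obtain ⟨Γ, h, -, hφΓ⟩ := (isTheory_self hL.normal).exists_mcs hL.normal hφ
  have hΓΓ := h.canonicalRel_refl hL
  have htop := typeOf_le_eventual hL h h hΓΓ φ
  let bdd : BoundedOrder (ModelWorld L φ Γ) :=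
    { bot := ⟨_, Γ, h, hΓΓ, rfl, le_rfl⟩
      bot_le := by
        rintro ⟨x, Δ, -, -, -, hle⟩
        exact hle
      top := ⟨_, eventual Γ, h.eventual_isMCS hL, h.canonicalRel_eventual hL h hΓΓ, rfl, htop⟩
      le_top := by
        rintro ⟨x, Δ, hΔ, hR, rfl, -⟩
        exact typeOf_le_eventual hL h hΔ hR φ }
  refine ⟨ModelWorld L φ Γ, finite_modelWorld L φ Γ, inferInstance, bdd,
    fun n y => var n ∈ y.1.loc, fun hsat => hφΓ ?_⟩
  exact (mem_typeOf_loc.1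
    ((satisfies_modelWorld hL h φ φ (self_mem_subformulas φ) _).1 hsat)).2

end FiniteModel

section Chains

variable {W : Type} [PartialOrder W] [BoundedOrder W]

open Classical in
/-- The greatest element of a chain (or `⊥` if it is empty); `⊤` for sets that are not chains. -/
noncomputable def chainMax (S : Set W) : W :=
  if h : IsChain (· ≤ ·) S ∧ ∃ m, IsGreatest (insert ⊥ S) m then h.2.choose else ⊤

theorem chainMax_eq {S : Set W} (hS : IsChain (· ≤ ·) S) {m : W}
    (hm : IsGreatest (insert ⊥ S) m) : chainMax S = m := by
  have h : IsChain (· ≤ ·) S ∧ ∃ m, IsGreatest (insert ⊥ S) m := ⟨hS, m, hm⟩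
  rw [chainMax, dif_pos h]
  exact h.2.choose_spec.unique hm

theorem chainMax_of_not_isChain {S : Set W} (hS : ¬ IsChain (· ≤ ·) S) : chainMax S = ⊤ :=
  dif_neg fun h => hS h.1

theorem chainMax_empty : chainMax (∅ : Set W) = ⊥ :=
  chainMax_eq Set.subsingleton_empty.isChain (by simp)

theorem isGreatest_chainMax [Finite W] {S : Set W} (hS : IsChain (· ≤ ·) S) :
    IsGreatest (insert ⊥ S) (chainMax S) := by
  have hS' : IsChain (· ≤ ·) (insert ⊥ S) := hS.insert fun b _ _ => Or.inl bot_le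
  obtain ⟨m, hm⟩ := (Set.toFinite (insert ⊥ S)).exists_maximal (Set.insert_nonempty _ _)
  have hmax : IsGreatest (insert ⊥ S) m :=
    ⟨hm.prop, fun y hy => (hS'.total hy hm.prop).elim id fun hmy => hm.le_of_ge hy hmy⟩
  rwa [chainMax_eq hS hmax]

theorem chainMax_mono [Finite W] : Monotone (chainMax : Set W → W) := by
  intro S T hST
  by_cases hT : IsChain (· ≤ ·) T
  · exact (isGreatest_chainMax hT).2
      (Set.insert_subset_insert hST (isGreatest_chainMax (hT.mono hST)).1)
  · exact (chainMax_of_not_isChain hT).symm ▸ le_top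

theorem chainMax_insert [Finite W] {S : Set W} {y : W} (hy : chainMax S ≤ y) :
    chainMax (insert y S) = y := by
  by_cases hS : IsChain (· ≤ ·) S
  · have hub : ∀ z ∈ S, z ≤ y := fun z hz =>
      ((isGreatest_chainMax hS).2 (Set.mem_insert_of_mem _ hz)).trans hy
    refine chainMax_eq (hS.insert fun b hb _ => Or.inr (hub b hb)) ⟨by simp, ?_⟩
    rintro z (rfl | rfl | hz)
    · exact bot_le
    · exact le_rfl
    · exact hub z hz
  · rw [chainMax_of_not_isChain hS, top_le_iff] at hy
    rw [chainMax_of_not_isChain fun h => hS (h.mono (Set.subset_insert _ _)), hy]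

end Chains

section Buttons

variable {U : Type} {N : KripkeModel U}

theorem satisfies_bigOr (u : U) (l : List Formula) :
    Satisfies N u (bigOr l) ↔ ∃ φ ∈ l, Satisfies N u φ := by
  induction l with
  | nil => simp [bigOr, Satisfies]
  | cons a l ih =>
    simp only [bigOr, disj, neg, Satisfies, ih, List.mem_cons, exists_eq_or_imp]
    tauto

theorem satisfies_bigAnd (u : U) (l : List Formula) :
    Satisfies N u (bigAnd l) ↔ ∀ φ ∈ l, Satisfies N u φ := by
  induction l with
  | nil => simp [bigAnd, tru, neg, Satisfies]
  | cons a l ih =>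
    simp only [bigAnd, conj, neg, Satisfies, ih, List.mem_cons, forall_eq_or_imp]
    tauto

theorem satisfies_dia (u : U) (φ : Formula) :
    Satisfies N u (dia φ) ↔ ∃ v, N.rel u v ∧ Satisfies N v φ := by
  change (¬ ∀ v, N.rel u v → ¬ Satisfies N v φ) ↔ _
  simp

theorem satisfies_labelFormula {W : Type} [Fintype W] (u : U) (Φ : W → Formula)
    (P : W → Prop) : Satisfies N u (labelFormula Φ P) ↔ ∃ w, P w ∧ Satisfies N u (Φ w) := by
  simp [labelFormula, satisfies_bigOr]

open Classical in
/-- The set of buttons already pushed at a world. -/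
noncomputable def pushed (N : KripkeModel U) {n : ℕ} (b : Fin n → Formula) (u : U) :
    Finset (Fin n) :=
  Finset.univ.filter fun i => Satisfies N u (box (b i))

variable {n : ℕ} {b : Fin n → Formula}

theorem mem_pushed {u : U} {i : Fin n} : i ∈ pushed N b u ↔ Satisfies N u (box (b i)) := by
  simp [pushed]

theorem satisfies_theta (u : U) (A : Finset (Fin n)) :
    Satisfies N u (Theta b A) ↔ pushed N b u = A := by
  simp only [Theta, satisfies_bigAnd, List.mem_map, Finset.mem_toList, Finset.mem_univ, true_and,
    forall_exists_index, forall_apply_eq_imp_iff, Finset.ext_iff, mem_pushed]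
  refine forall_congr' fun i => ?_
  split_ifs with h
  · simp [h]
  · simp only [h, iff_false]
    rfl

theorem pushed_mono (htrans : Transitive N.rel) {u v : U} (huv : N.rel u v) :
    pushed N b u ⊆ pushed N b v := by
  intro i hi
  rw [mem_pushed] at hi ⊢
  exact fun w hvw => hi w (htrans huv hvw)

theorem IndependentButtons.exists_pushed_eq {u0 : U} (h : IndependentButtons N u0 b) {u : U}
    (hu : N.rel u0 u) {A : Finset (Fin n)} (hA : pushed N b u ⊆ A) :
    ∃ v, N.rel u v ∧ pushed N b v = A := by
  simpa only [satisfies_dia, satisfies_theta] using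
    h.2 _ u hu ((satisfies_theta u _).2 rfl) A hA

theorem IndependentButtons.pushed_initial {u0 : U} (h : IndependentButtons N u0 b) :
    pushed N b u0 = ∅ :=
  Finset.eq_empty_of_forall_notMem fun i hi => h.1 i (mem_pushed.1 hi)

/-- A bounded morphism from button patterns to a frame yields a labeling by formulas. -/
theorem IndependentButtons.satisfies_subst {u0 : U} (h : IndependentButtons N u0 b)
    (htrans : Transitive N.rel) (hinit : ∀ u, N.rel u0 u) {W : Type} (M : KripkeModel W)
    (f : Finset (Fin n) → W) (forth : ∀ A B, A ⊆ B → M.rel (f A) (f B))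
    (back : ∀ A y, M.rel (f A) y → ∃ B, A ⊆ B ∧ f B = y) (φ : Formula) :
    ∀ u, Satisfies N u (φ.subst fun k => labelFormula (Theta b) fun A => M.val k (f A)) ↔
      Satisfies M (f (pushed N b u)) φ := by
  induction φ with
  | var k =>
    intro u
    simp [Formula.subst, satisfies_labelFormula, satisfies_theta, Satisfies]
  | fls => exact fun _ => Iff.rfl
  | impl a c iha ihc =>
    intro u
    simp only [Formula.subst, Satisfies, iha, ihc]
  | box a iha =>
    intro u
    simp only [Formula.subst, Satisfies, iha]
    constructor
    · intro hall y hy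
      obtain ⟨B, hAB, rfl⟩ := back _ y hy
      obtain ⟨v, huv, rfl⟩ := h.exists_pushed_eq (hinit u) hAB
      exact hall v huv
    · exact fun hall v huv => hall _ (forth _ _ (pushed_mono htrans huv))

end Buttons

/-- If u₀ is an initial world of a reflexive transitive Kripke model N that
admits arbitrarily large finite families of independent buttons, then every formula valid
at u₀ is provable in Grz.2. -/
theorem statement13 {U : Type} (N : KripkeModel U) (u0 : U)
    (hrefl : Reflexive N.rel) (htrans : Transitive N.rel) (hinit : ∀ u, N.rel u0 u)
    (hb : ∀ n : ℕ, ∃ b : Fin n → Formula, IndependentButtons N u0 b) :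
    ∀ φ : Formula, (∀ σ : ℕ → Formula, Satisfies N u0 (φ.subst σ)) → φ ∈ Grz2 := by
  intro φ hφ L ⟨hN, hAx⟩
  by_contra hφL
  have hL : IsGrz2Logic L := ⟨hN, hAx (by simp), hAx (by simp)⟩
  obtain ⟨W, _, _, _, val, hcounter⟩ := exists_finite_countermodel hL hφL
  let e := Finite.equivFin W
  obtain ⟨b, hind⟩ := hb (Nat.card W)
  refine hcounter ?_
  have key := hind.satisfies_subst htrans hinit ⟨(· ≤ ·), val⟩
    (fun A => chainMax (e.symm '' (A : Set (Fin (Nat.card W)))))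
    (fun A B hAB => chainMax_mono (Set.image_mono (Finset.coe_subset.2 hAB)))
    (fun A y hy => ⟨insert (e y) A, Finset.subset_insert _ _, by
      simpa [Set.image_insert_eq] using chainMax_insert hy⟩) φ u0
  rw [hind.pushed_initial] at key
  simpa [chainMax_empty] using key.1 (hφ _)

end GrzPaper
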